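/- arXiv:1712.07264 — 4 statements merged into one kernel-verified Lean document; each statement's English description precedes it below -/
import Mathlib

section
/- Let f : ℝ → ℂ be a continuous positive definite function. Then there exists a unique finite positive Borel measure μ on ℝ such that f(x) = ∫ℝ e^{i x λ} dμ(λ) for all x ∈ ℝ. -/
open MeasureTheory ComplexOrder

open Filter Topology ProbabilityTheory

def PDfun (f : ℝ → ℂ) : Prop := ∀ (n : ℕ) (x : Fin n → ℝ) (c : Fin n → ℂ),
      0 ≤ ∑ i, ∑ j, c i * (starRingEnd ℂ) (c j) * f (x i - x j)

lemma PDfun.zero {f : ℝ → ℂ} (h : PDfun f) : 0 ≤ f 0 := by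
  simpa using h 1 (fun _ => 0) (fun _ => 1)

lemma PDfun.two {f : ℝ → ℂ} (h : PDfun f) (x : ℝ) (a b : ℂ) :
    0 ≤ a * (starRingEnd ℂ) a * f 0 + a * (starRingEnd ℂ) b * f x +
      (b * (starRingEnd ℂ) a * f (-x) + b * (starRingEnd ℂ) b * f 0) := by
  simpa [Fin.sum_univ_two] using h 2 ![x, 0] ![a, b]

lemma PDfun.neg {f : ℝ → ℂ} (h : PDfun f) (x : ℝ) : f (-x) = (starRingEnd ℂ) (f x) := by
  have h0 := h.zero
  have h1 := h.two x 1 1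
  have h2 := h.two x 1 Complex.I
  rw [Complex.nonneg_iff] at h0 h1 h2
  simp at h0 h1 h2
  apply Complex.ext
  · simp; linarith [h2.2, h0.2]
  · simp; linarith [h1.2, h0.2]

lemma PDfun.norm_le {f : ℝ → ℂ} (h : PDfun f) (x : ℝ) : ‖f x‖ ≤ (f 0).re := by
  have h0 := h.zero
  have h0' : f 0 = ((f 0).re : ℂ) := by
    rw [Complex.nonneg_iff] at h0
    apply Complex.ext <;> simp [h0.2.symm]
  have h1 := h.two x ((starRingEnd ℂ) (f x)) (-(‖f x‖ : ℂ))
  rw [h.neg, h0'] at h1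
  have e : (starRingEnd ℂ) (f x) * f x = ((‖f x‖ ^ 2 : ℝ) : ℂ) := by
    rw [mul_comm, Complex.mul_conj, Complex.normSq_eq_norm_sq]
  have h2 : (0:ℂ) ≤ ((2 * ‖f x‖ ^ 2 * ((f 0).re - ‖f x‖) : ℝ) : ℂ) := by
    convert h1 using 1
    simp only [map_neg, Complex.conj_conj, Complex.conj_ofReal]
    push_cast
    push_cast at e
    linear_combination (-(((f 0).re : ℂ)) + 2 * (‖f x‖ : ℂ)) * e
  have h3 : 0 ≤ 2 * ‖f x‖ ^ 2 * ((f 0).re - ‖f x‖) := by exact_mod_cast h2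
  by_contra! hc
  have hn : 0 ≤ (f 0).re := (Complex.nonneg_iff.1 h0).1
  have : 0 < ‖f x‖ := by linarith
  have : 0 < ‖f x‖ ^ 2 * (‖f x‖ - (f 0).re) := mul_pos (by positivity) (by linarith)
  nlinarith

lemma PDfun.finset {f : ℝ → ℂ} (h : PDfun f) (s : Finset ℝ) (c : ℝ → ℂ) :
    0 ≤ ∑ a ∈ s, ∑ b ∈ s, c a * (starRingEnd ℂ) (c b) * f (a - b) := by
  have := h s.card (fun i => (s.equivFin.symm i : ℝ)) (fun i => c (s.equivFin.symm i))
  rw [← Finset.sum_coe_sort]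
  simp_rw [← Finset.sum_coe_sort s]
  rw [← Equiv.sum_comp s.equivFin.symm]
  convert this using 2 with i
  rw [← Equiv.sum_comp s.equivFin.symm]

lemma PDfun.mul_exp {f : ℝ → ℂ} (h : PDfun f) (w : ℝ) :
    PDfun (fun x => f x * Complex.exp (-(x * w) * Complex.I)) := by
  intro n x c
  refine (h n x (fun i => c i * Complex.exp (-(x i * w) * Complex.I))).trans_eq ?_
  refine Finset.sum_congr rfl fun i _ => Finset.sum_congr rfl fun j _ => ?_
  rw [map_mul, ← Complex.exp_conj]
  simp only [map_mul, map_neg, Complex.conj_ofReal, Complex.conj_I]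
  have : Complex.exp (-(((x i - x j : ℝ) : ℂ) * w) * Complex.I)
    = Complex.exp (-(x i * w) * Complex.I) * Complex.exp (-(x j * w) * -Complex.I) := by
    rw [← Complex.exp_add]; congr 1; push_cast; ring
  rw [this]; ring

lemma integral_comp_simple (μ : Measure ℝ) [IsFiniteMeasure μ] (q : SimpleFunc ℝ ℝ) (g : ℝ → ℂ) :
    ∫ x, g (q x) ∂μ = ∑ a ∈ q.range, (μ.real (q ⁻¹' {a}) : ℂ) * g a := by
  have : ∀ x, g (q x) = ∑ a ∈ q.range, (q ⁻¹' {a}).indicator (fun _ => g a) x := by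
    intro x
    rw [Finset.sum_eq_single (q x)]
    · simp
    · intro b _ hb
      simp [Set.indicator, hb.symm]
    · simp
  simp_rw [this]
  rw [integral_finsetSum]
  · refine Finset.sum_congr rfl fun a _ => ?_
    rw [integral_indicator (q.measurableSet_fiber a)]
    simp
  · intro a _
    exact (integrable_const _).indicator (q.measurableSet_fiber a)

lemma PDfun.double {f : ℝ → ℂ} (h : PDfun f) (hf : Continuous f) (μ : Measure ℝ)
    [IsFiniteMeasure μ] : 0 ≤ ∫ x, ∫ y, f (x - y) ∂μ ∂μ := by
  let q : ℕ → SimpleFunc ℝ ℝ := fun n =>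
    SimpleFunc.approxOn id measurable_id Set.univ 0 (Set.mem_univ _) n
  have hq : ∀ x, Tendsto (fun n => q n x) atTop (𝓝 x) := fun x =>
    SimpleFunc.tendsto_approxOn measurable_id (Set.mem_univ _) (by simp)
  have hpos : ∀ n, 0 ≤ ∫ x, ∫ y, f (q n x - q n y) ∂μ ∂μ := by
    intro n
    have e1 : ∀ x, ∫ y, f (q n x - q n y) ∂μ = ∑ a ∈ (q n).range,
        (μ.real (q n ⁻¹' {a}) : ℂ) * f (q n x - a) := fun x =>
      integral_comp_simple μ (q n) (fun y => f (q n x - y))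
    simp_rw [e1]
    rw [integral_comp_simple μ (q n) (fun x => ∑ a ∈ (q n).range,
        (μ.real (q n ⁻¹' {a}) : ℂ) * f (x - a))]
    convert h.finset (q n).range (fun a => (μ.real (q n ⁻¹' {a}) : ℂ)) using 2 with a
    rw [Finset.mul_sum]
    refine Finset.sum_congr rfl fun b _ => ?_
    simp [mul_assoc]
  have inner : ∀ x, Tendsto (fun n => ∫ y, f (q n x - q n y) ∂μ) atTop
      (𝓝 (∫ y, f (x - y) ∂μ)) := by
    intro x
    refine tendsto_integral_of_dominated_convergence (fun _ => (f 0).re) ?_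
      (integrable_const _) ?_ ?_
    · intro n
      exact (hf.measurable.comp (measurable_const.sub (q n).measurable)).aestronglyMeasurable
    · intro n; exact .of_forall fun y => h.norm_le _
    · exact .of_forall fun y => (hf.tendsto _).comp ((hq x).sub (hq y))
  have outer : Tendsto (fun n => ∫ x, ∫ y, f (q n x - q n y) ∂μ ∂μ) atTop
      (𝓝 (∫ x, ∫ y, f (x - y) ∂μ ∂μ)) := by
    refine tendsto_integral_of_dominated_convergence (fun _ => (f 0).re * μ.real Set.univ) ?_
      (integrable_const _) ?_ (.of_forall inner)
    · intro n
      have : StronglyMeasurable (fun p : ℝ × ℝ => f (q n p.1 - q n p.2)) := by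
        have := (q n).measurable
        exact (hf.measurable.comp (by fun_prop)).stronglyMeasurable
      exact this.integral_prod_right.aestronglyMeasurable
    · intro n; refine .of_forall fun x => ?_
      exact norm_integral_le_of_norm_le_const (.of_forall fun y => h.norm_le _)
  exact ge_of_tendsto' outer hpos

lemma PDfun.gauss {f : ℝ → ℂ} (h : PDfun f) (hf : Continuous f) (v : NNReal) :
    0 ≤ ∫ x, f x ∂(gaussianReal 0 v) := by
  have h1 := h.double hf (gaussianReal 0 (v / 2))
  have e : gaussianReal 0 v = (gaussianReal 0 (v / 2)).conv ((gaussianReal 0 (v / 2))) := by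
    rw [gaussianReal_conv_gaussianReal]; simp
  have hi : ∀ m : Measure ℝ, IsFiniteMeasure m → Integrable f m := fun m _ =>
    Integrable.of_bound hf.aestronglyMeasurable ((f 0).re) (.of_forall h.norm_le)
  rw [e, integral_conv (hi _ inferInstance)]
  convert h1 using 3 with x
  have : gaussianReal 0 (v / 2) = (gaussianReal 0 (v / 2)).map (fun x => -x) := by
    rw [gaussianReal_map_neg]; simp
  conv_lhs => rw [this]
  rw [integral_map (by fun_prop) (by fun_prop)]
  rfl

lemma scale_eq {f : ℝ → ℂ} (k : NNReal) (hk : k ≠ 0) (x : ℝ) :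
    (k : ℂ) ^ 2 * ∫ u, f u * Complex.exp (-((k : ℂ) ^ 2 * (x - u) ^ 2 / 2)) ∂(gaussianReal 0 (k ^ 2))
      = ∫ t, f (x + t / k) * Complex.exp (-((x + t / k) ^ 2 / (2 * k ^ 2))) ∂(gaussianReal 0 1) := by
  rw [integral_gaussianReal_eq_integral_smul (by positivity),
    integral_gaussianReal_eq_integral_smul (by simp)]
  have hk' : (0:ℝ) < k := by positivity
  have hkc : (k : ℂ) ≠ 0 := by exact_mod_cast hk
  let G : ℝ → ℂ := fun u => gaussianPDFReal 0 1 (k * (u - x)) •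
    (f u * Complex.exp (-((u : ℂ) ^ 2 / (2 * k ^ 2))))
  have e1 : ∀ t : ℝ, gaussianPDFReal 0 1 t •
      (f (x + t / k) * Complex.exp (-(((x : ℂ) + t / k) ^ 2 / (2 * k ^ 2)))) = G (x + t / k) := by
    intro t
    have : (k : ℝ) * (x + t / k - x) = t := by field_simp; ring
    simp only [G, this]
    push_cast
    rfl
  simp_rw [e1]
  have e2 : ∫ t : ℝ, G (x + t / k) = (k : ℂ) * ∫ u, G u := by
    have := Measure.integral_comp_div (fun u => G (x + u)) (k : ℝ)
    rw [this, integral_add_left_eq_self, abs_of_pos hk']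
    simp
  rw [e2, pow_two, mul_assoc]
  congr 1
  rw [← integral_const_mul]
  congr 1
  ext u
  simp only [G, gaussianPDFReal, Complex.real_smul]
  push_cast
  have hs : √(2 * Real.pi * (k : ℝ) ^ 2) = √(2 * Real.pi) * k := by
    rw [Real.sqrt_mul (by positivity), Real.sqrt_sq hk'.le]
  rw [hs]
  push_cast
  have hp : ((√(2 * Real.pi) : ℝ) : ℂ) ≠ 0 := by
    have : √(2 * Real.pi) ≠ 0 := by positivity
    exact_mod_cast this
  have hE : Complex.exp (-((u : ℂ) - 0) ^ 2 / (2 * k ^ 2)) *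
      Complex.exp (-((k : ℂ) ^ 2 * (x - u) ^ 2 / 2)) =
      Complex.exp (-((k : ℂ) * (u - x) - 0) ^ 2 / (2 * 1)) *
        Complex.exp (-((u : ℂ) ^ 2 / (2 * k ^ 2))) := by
    rw [← Complex.exp_add, ← Complex.exp_add]
    congr 1; field_simp; ring
  simp only [mul_one] at hE ⊢
  rw [← pow_two (k : ℂ)]
  generalize Complex.exp (-((u : ℂ) - 0) ^ 2 / (2 * k ^ 2)) = A at *
  generalize Complex.exp (-((k : ℂ) ^ 2 * (x - u) ^ 2 / 2)) = B at *
  generalize Complex.exp (-((k : ℂ) * (u - x) - 0) ^ 2 / 2) = C at *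
  generalize Complex.exp (-((u : ℂ) ^ 2 / (2 * k ^ 2))) = D at *
  field_simp
  linear_combination (f u) * hE

lemma PDfun.exists_measure {f : ℝ → ℂ} (h : PDfun f) (hf : Continuous f) (k : NNReal) (hk : k ≠ 0) :
    ∃ μ : Measure ℝ, IsFiniteMeasure μ ∧ ∀ x : ℝ, charFun μ x =
      ∫ t, f (x + t / k) * Complex.exp (-((x + t / k) ^ 2 / (2 * k ^ 2))) ∂(gaussianReal 0 1) := by
  let H : ℝ → ℂ := fun w => ∫ u, f u * Complex.exp (-(u * w) * Complex.I) ∂(gaussianReal 0 (k ^ 2))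
  have Hpos : ∀ w, 0 ≤ H w := fun w => (h.mul_exp w).gauss (by fun_prop) _
  have Hre : ∀ w, (((H w).re : ℝ) : ℂ) = H w := fun w => by
    have := Complex.nonneg_iff.1 (Hpos w)
    apply Complex.ext <;> simp [this.2.symm]
  have ne : ∀ a : ℝ, ‖Complex.exp (a * Complex.I)‖ = 1 := Complex.norm_exp_ofReal_mul_I
  have Hsm : StronglyMeasurable H := by
    have : StronglyMeasurable (fun p : ℝ × ℝ => f p.2 * Complex.exp (-(p.2 * p.1) * Complex.I)) := by
      apply Continuous.stronglyMeasurable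
      fun_prop
    exact this.integral_prod_right
  have Hbd : ∀ w, ‖H w‖ ≤ (f 0).re := fun w => by
    have := norm_integral_le_of_norm_le_const (μ := gaussianReal 0 (k ^ 2)) (C := (f 0).re)
      (f := fun u : ℝ => f u * Complex.exp (-(u * w) * Complex.I)) (.of_forall fun u => by
        have := ne (-(u * w))
        push_cast at this
        rw [norm_mul, this, mul_one]; exact h.norm_le u)
    rwa [probReal_univ, mul_one] at this
  let ρ : ℝ → NNReal := fun w => (k ^ 2) * Real.toNNReal (H w).re
  have hρ : Measurable ρ := by
    have := Hsm.measurable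
    fun_prop
  refine ⟨(gaussianReal 0 (k ^ 2)).withDensity (fun w => ρ w), ?_, ?_⟩
  · apply isFiniteMeasure_withDensity (ne_of_lt _)
    have : ∀ w, (ρ w : ENNReal) ≤ ((k ^ 2 * Real.toNNReal ((f 0).re) : NNReal) : ENNReal) := fun w => by
      have : (H w).re ≤ (f 0).re := (Complex.re_le_norm _).trans (Hbd w)
      simp only [ρ]
      gcongr
    refine (lintegral_mono this).trans_lt ?_
    simp only [lintegral_const, measure_univ, mul_one]
    exact ENNReal.coe_lt_top
  · intro x
    rw [← scale_eq k hk, charFun_apply_real, integral_withDensity_eq_integral_smul hρ]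
    have e1 : ∀ w : ℝ, ρ w • Complex.exp (x * w * Complex.I) = (k : ℂ) ^ 2 *
        ∫ u, f u * Complex.exp ((x - u : ℝ) * w * Complex.I) ∂(gaussianReal 0 (k ^ 2)) := by
      intro w
      have : ((ρ w : ℝ) : ℂ) = (k : ℂ) ^ 2 * H w := by
        simp only [ρ]
        push_cast
        rw [Real.coe_toNNReal _ (Complex.nonneg_iff.1 (Hpos w)).1, Hre w]
      rw [NNReal.smul_def, Complex.real_smul, this, mul_assoc, ← integral_mul_const]
      congr 2
      ext u
      rw [mul_assoc, ← Complex.exp_add]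
      congr 2; push_cast; ring
    simp_rw [e1]
    rw [integral_const_mul, integral_integral_swap]
    · congr 2
      ext u
      rw [integral_const_mul]
      congr 1
      have := charFun_gaussianReal (μ := 0) (v := k ^ 2) (x - u)
      rw [charFun_apply_real] at this
      rw [this]
      congr 1; push_cast; ring
    · refine Integrable.of_bound (C := (f 0).re) ?_ (.of_forall fun p => ?_)
      · apply Continuous.aestronglyMeasurable
        unfold Function.uncurry
        fun_prop
      · have := ne ((x - p.2) * p.1)
        push_cast at this
        simp only [Function.uncurry]
        push_cast
        rw [norm_mul, this, mul_one]; exact h.norm_le _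

lemma PDfun.tendsto {f : ℝ → ℂ} (h : PDfun f) (hf : Continuous f) (x : ℝ) :
    Tendsto (fun n : ℕ => ∫ t, f (x + t / ((n + 1 : NNReal) : ℝ)) *
      Complex.exp (-((x + t / ((n + 1 : NNReal) : ℝ)) ^ 2 / (2 * ((n + 1 : NNReal) : ℝ) ^ 2)))
        ∂(gaussianReal 0 1)) atTop (𝓝 (f x)) := by
  have : f x = ∫ t : ℝ, f x * Complex.exp (0) ∂(gaussianReal 0 1) := by simp
  rw [this]
  have hz : Tendsto (fun n : ℕ => (((n + 1 : NNReal) : ℝ))⁻¹) atTop (𝓝 0) := by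
    have := tendsto_one_div_add_atTop_nhds_zero_nat (𝕜 := ℝ)
    simpa using this
  refine tendsto_integral_of_dominated_convergence (fun _ => (f 0).re) ?_
      (integrable_const _) ?_ ?_
  · intro n
    apply Continuous.aestronglyMeasurable
    fun_prop
  · intro n
    refine .of_forall fun t => ?_
    rw [norm_mul]
    refine (mul_le_of_le_one_right (norm_nonneg _) ?_).trans (h.norm_le _)
    have e : (-(((x : ℂ) + t / ((n + 1 : NNReal) : ℝ)) ^ 2 / (2 * ((n + 1 : NNReal) : ℝ) ^ 2)))
      = ((-((x + t / ((n + 1 : NNReal) : ℝ)) ^ 2 / (2 * ((n + 1 : NNReal) : ℝ) ^ 2)) : ℝ) : ℂ) := by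
      push_cast; rfl
    rw [e, Complex.norm_exp_ofReal, Real.exp_le_one_iff, neg_nonpos]
    positivity
  · refine .of_forall fun t => ?_
    have hx : Tendsto (fun n : ℕ => x + t / ((n + 1 : NNReal) : ℝ)) atTop (𝓝 x) := by
      have := (hz.const_mul t).const_add x
      simpa [div_eq_mul_inv] using this
    refine ((hf.tendsto _).comp hx).mul ((Complex.continuous_exp.tendsto _).comp ?_)
    have h2 : Tendsto (fun n : ℕ => -((x + t / ((n + 1 : NNReal) : ℝ)) ^ 2 / (2 * ((n + 1 : NNReal) : ℝ) ^ 2)))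
      atTop (𝓝 0) := by
      have := (((hx.pow 2).mul (hz.pow 2)).mul_const (1/2)).neg
      convert this using 2
      · field_simp
      · simp
    have := (Complex.continuous_ofReal.tendsto _).comp h2
    convert this using 2 with n
    · simp
    · simp

lemma PDfun.exists_one {f : ℝ → ℂ} (h : PDfun f) (hf : Continuous f) (h1 : f 0 = 1) :
    ∃ μ : Measure ℝ, IsFiniteMeasure μ ∧ ∀ x : ℝ, charFun μ x = f x := by
  choose μ hμ hc using fun n : ℕ => h.exists_measure hf (n + 1 : NNReal) (by positivity)
  have ht : ∀ x, Tendsto (fun n => charFun (μ n) x) atTop (𝓝 (f x)) := fun x => by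
    simp_rw [hc]
    exact h.tendsto hf x
  have hm : Tendsto (fun n => (μ n).real Set.univ) atTop (𝓝 1) := by
    have := ht 0
    simp_rw [charFun_zero, h1] at this
    have h6 := (Complex.continuous_re.tendsto _).comp this
    simpa [Function.comp_def] using h6
  have hex : ∀ n, ∃ p : ProbabilityMeasure ℝ, μ n ≠ 0 →
      (p : Measure ℝ) = (μ n Set.univ)⁻¹ • μ n := by
    intro n
    by_cases hn : μ n = 0
    · exact ⟨⟨Measure.dirac 0, inferInstance⟩, fun h => absurd hn h⟩
    · haveI : NeZero (μ n) := ⟨hn⟩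
      exact ⟨⟨(μ n Set.univ)⁻¹ • μ n, isProbabilityMeasureSMul⟩, fun _ => rfl⟩
  choose P hPe using hex
  have hP : ∀ x, Tendsto (fun n => charFun (P n : Measure ℝ) x) atTop (𝓝 (f x)) := fun x => by
    have hne : ∀ᶠ n in atTop, (μ n).real Set.univ ≠ 0 := hm.eventually_ne one_ne_zero
    have h3 : Tendsto (fun n => (((μ n).real Set.univ : ℝ) : ℂ)⁻¹ * charFun (μ n) x) atTop
        (𝓝 (f x)) := by
      have h4 : Tendsto (fun n => (((μ n).real Set.univ : ℝ) : ℂ)) atTop (𝓝 ((1 : ℝ) : ℂ)) :=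
        (Complex.continuous_ofReal.tendsto _).comp hm
      have := (h4.inv₀ (by simp)).mul (ht x)
      simpa using this
    refine h3.congr' ?_
    filter_upwards [hne] with n hn
    have hn0 : μ n ≠ 0 := by rintro h0; simp [h0] at hn
    rw [hPe n hn0, charFun_apply, charFun_apply, integral_smul_measure]
    simp [Measure.real]
  have tight := isTightMeasureSet_of_tendsto_charFun (μ := fun n => (P n : Measure ℝ))
    (hf.continuousAt) hP
  have hcomp : IsCompact (closure (Set.range P)) := by
    apply isCompact_closure_of_isTightMeasureSet
    convert tight using 1
    ext m; simp
  let U : Ultrafilter ℕ := hyperfilter ℕ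
  obtain ⟨Q, -, hQ⟩ := hcomp.ultrafilter_le_nhds (U.map P) (by
    simp only [le_principal_iff, Ultrafilter.coe_map, mem_map]
    exact univ_mem' fun n => subset_closure ⟨n, rfl⟩)
  have hQ' : Tendsto P U (𝓝 Q) := hQ
  refine ⟨Q, inferInstance, fun x => ?_⟩
  rw [ProbabilityMeasure.tendsto_iff_forall_integral_rclike_tendsto ℂ] at hQ'
  have h5 := hQ' (BoundedContinuousFunction.innerProbChar x)
  simp_rw [← charFun_eq_integral_innerProbChar] at h5
  have hU : (U : Filter ℕ) ≤ atTop := Nat.hyperfilter_le_atTop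
  exact tendsto_nhds_unique h5 ((hP x).mono_left hU)

lemma PDfun.exists_all {f : ℝ → ℂ} (h : PDfun f) (hf : Continuous f) :
    ∃ μ : Measure ℝ, IsFiniteMeasure μ ∧ ∀ x : ℝ, charFun μ x = f x := by
  have h0 := Complex.nonneg_iff.1 h.zero
  have hre : (((f 0).re : ℝ) : ℂ) = f 0 := by
    apply Complex.ext <;> simp [h0.2.symm]
  rcases h0.1.eq_or_lt with hz | hz
  · refine ⟨0, inferInstance, fun x => ?_⟩
    have := h.norm_le x
    rw [← hz] at this
    simp [norm_le_zero_iff.1 this]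
  · set r := (f 0).re with hr
    have hrc : (r : ℂ) ≠ 0 := by exact_mod_cast hz.ne'
    have hp : PDfun (fun x => (r : ℂ)⁻¹ * f x) := by
      intro n x c
      have := h n x c
      have h2 : (0 : ℂ) ≤ (r : ℂ)⁻¹ := by
        rw [← Complex.ofReal_inv]; exact_mod_cast (inv_pos.2 hz).le
      refine (mul_nonneg h2 this).trans_eq ?_
      rw [Finset.mul_sum]
      refine Finset.sum_congr rfl fun i _ => ?_
      rw [Finset.mul_sum]
      refine Finset.sum_congr rfl fun j _ => ?_
      ring
    obtain ⟨μ, hμ, hc⟩ := hp.exists_one (by fun_prop) (by rw [← hre]; field_simp)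
    refine ⟨(r.toNNReal) • μ, inferInstance, fun x => ?_⟩
    have := hc x
    rw [charFun_apply] at this ⊢
    rw [integral_smul_nnreal_measure, this, NNReal.smul_def, Real.coe_toNNReal _ hz.le,
      Complex.real_smul]
    field_simp

/-- Bochner's theorem: a continuous positive definite function `f : ℝ → ℂ` is the
Fourier transform `f(x) = ∫ e^{ixλ} dμ(λ)` of a unique finite positive Borel measure. -/
theorem stmt_1 (f : ℝ → ℂ) (hf : Continuous f)
    (hpd : ∀ (n : ℕ) (x : Fin n → ℝ) (c : Fin n → ℂ),
      0 ≤ ∑ i, ∑ j, c i * (starRingEnd ℂ) (c j) * f (x i - x j)) :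
    ∃! μ : Measure ℝ, IsFiniteMeasure μ ∧
      ∀ x : ℝ, f x = ∫ l : ℝ, Complex.exp (Complex.I * x * l) ∂μ := by
  have key : ∀ (μ : Measure ℝ) (x : ℝ),
      ∫ l : ℝ, Complex.exp (Complex.I * x * l) ∂μ = charFun μ x := by
    intro μ x
    rw [charFun_apply_real]
    congr 1
    ext l
    congr 1
    ring
  simp_rw [key]
  obtain ⟨μ, hμ, hc⟩ := PDfun.exists_all hpd hf
  refine ⟨μ, ⟨hμ, fun x => (hc x).symm⟩, ?_⟩
  rintro ν ⟨hν, hνc⟩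
  apply Measure.ext_of_charFun
  ext x
  rw [hc, hνc]
end

section
/- Let μ be a finite positive Borel measure on ℝ. Then the set of Fourier transforms {φ̂ : φ is a smooth compactly supported function ℝ → ℂ} is dense in L²(ℝ, μ). -/
open MeasureTheory

lemma aux_integrable (φ : ℝ → ℂ) (hφ : Integrable φ) (l : ℝ) :
    Integrable (fun x : ℝ => φ x * Complex.exp (Complex.I * l * x)) := by
  refine hφ.mono (hφ.1.mul (Continuous.aestronglyMeasurable (by fun_prop))) ?_
  refine Filter.Eventually.of_forall fun x => ?_
  have : Complex.I * l * x = ((l * x : ℝ) : ℂ) * Complex.I := by push_cast; ring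
  rw [norm_mul, this, Complex.norm_exp_ofReal_mul_I, mul_one]

lemma aux_bound (φ : ℝ → ℂ) (l : ℝ) :
    ‖∫ x : ℝ, φ x * Complex.exp (Complex.I * l * x)‖ ≤ ∫ x : ℝ, ‖φ x‖ := by
  refine (norm_integral_le_integral_norm _).trans (le_of_eq ?_)
  congr 1
  ext x
  have : Complex.I * l * x = ((l * x : ℝ) : ℂ) * Complex.I := by push_cast; ring
  rw [norm_mul, this, Complex.norm_exp_ofReal_mul_I, mul_one]

lemma aux_cont (φ : ℝ → ℂ) (hφ : Integrable φ) :
    Continuous (fun l : ℝ => ∫ x : ℝ, φ x * Complex.exp (Complex.I * l * x)) := by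
  refine continuous_of_dominated (bound := fun x => ‖φ x‖)
    (fun l => (aux_integrable φ hφ l).1) (fun l => ?_) hφ.norm ?_
  · refine Filter.Eventually.of_forall fun x => ?_
    have : Complex.I * l * x = ((l * x : ℝ) : ℂ) * Complex.I := by push_cast; ring
    rw [norm_mul, this, Complex.norm_exp_ofReal_mul_I, mul_one]
  · exact Filter.Eventually.of_forall fun x => by fun_prop

open FourierTransform in
lemma aux_inv (h : ℝ → ℂ) (hc : HasCompactSupport h) (hs : ContDiff ℝ (⊤ : ℕ∞) h) :
    ∃ φ : ℝ → ℂ, Integrable φ ∧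
      ∀ l : ℝ, ∫ x : ℝ, φ x * Complex.exp (Complex.I * l * x) = h l := by
  let s : SchwartzMap ℝ ℂ := hc.toSchwartzMap hs
  let ψ : SchwartzMap ℝ ℂ := 𝓕⁻ s
  have hψ : ∀ l, 𝓕 (ψ : ℝ → ℂ) l = h l := by
    intro l
    rw [← SchwartzMap.fourier_coe]
    have : 𝓕 ψ = s := FourierTransform.fourier_fourierInv_eq s
    rw [this]
    rfl
  have hpi : (-(2 * Real.pi)⁻¹ : ℝ) ≠ 0 := by
    have := Real.pi_pos
    simp [this.ne']
  refine ⟨fun x => ((2 * Real.pi)⁻¹ : ℝ) * ψ (-(2 * Real.pi)⁻¹ * x),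
    (ψ.integrable.comp_mul_left' hpi).const_mul _, fun l => ?_⟩
  rw [← hψ l, Real.fourier_real_eq_integral_exp_smul]
  have key := Measure.integral_comp_mul_left
    (fun v : ℝ => Complex.exp (((-2 * Real.pi * v * l : ℝ) : ℂ) * Complex.I) • ψ v)
    (-(2 * Real.pi)⁻¹)
  have hp := Real.pi_pos
  have e1 : |(-(2 * Real.pi)⁻¹)⁻¹| = 2 * Real.pi := by
    rw [inv_neg, inv_inv, abs_neg, abs_of_pos (by positivity)]
  rw [e1] at key
  have e2 : ∀ x : ℝ, (((2 * Real.pi)⁻¹ : ℝ) : ℂ) * ψ (-(2 * Real.pi)⁻¹ * x) *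
      Complex.exp (Complex.I * l * x) = (((2 * Real.pi)⁻¹ : ℝ) : ℂ) *
      (Complex.exp (((-2 * Real.pi * (-(2 * Real.pi)⁻¹ * x) * l : ℝ) : ℂ) * Complex.I) •
        ψ (-(2 * Real.pi)⁻¹ * x)) := by
    intro x
    have : -2 * Real.pi * (-(2 * Real.pi)⁻¹ * x) * l = l * x := by
      field_simp
    rw [this, smul_eq_mul]
    push_cast
    rw [show Complex.I * l * x = l * x * Complex.I by ring]
    ring
  simp_rw [e2]
  rw [integral_const_mul, key, Complex.real_smul, ← mul_assoc, ← Complex.ofReal_mul,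
    inv_mul_cancel₀ (by positivity)]
  simp

/-- For a finite positive Borel measure `μ` on `ℝ`, the Fourier transforms
`φ̂(λ) = ∫ φ(x) e^{iλx} dx` of smooth compactly supported functions `φ` form a
dense subset of `L²(ℝ, μ)`. -/
theorem stmt_4 (μ : Measure ℝ) [IsFiniteMeasure μ] :
    Dense {g : Lp ℂ 2 μ | ∃ φ : ℝ → ℂ, ContDiff ℝ (⊤ : ℕ∞) φ ∧ HasCompactSupport φ ∧
      (g : ℝ → ℂ) =ᵐ[μ] fun l : ℝ => ∫ x : ℝ, φ x * Complex.exp (Complex.I * l * x)} := by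
  rw [← dense_closure]
  refine (Lp.dense_hasCompactSupport_contDiff (F := ℂ) (μ := μ) (p := 2) (by simp)).mono ?_
  rintro f ⟨h, hfh, hc, hs⟩
  obtain ⟨φ₀, hφ₀, hφh⟩ := aux_inv h hc hs
  rw [Metric.mem_closure_iff]
  intro ε hε
  set C : ℝ := (measureUnivNNReal μ : ℝ) ^ (2 : ENNReal).toReal⁻¹ with hC
  have hC0 : 0 ≤ C := by positivity
  have hδ : 0 < ε / (C + 1) := by positivity
  obtain ⟨φ, hφc, hφs, hφ⟩ := MemLp.exist_eLpNorm_sub_le (p := 1) (by simp) le_rfl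
    (memLp_one_iff_integrable.2 hφ₀) hδ
  have hφi : Integrable φ := hφs.continuous.integrable_of_hasCompactSupport hφc
  have hL1 : ∫ x, ‖φ₀ x - φ x‖ ≤ ε / (C + 1) := by
    change ∫ x, ‖(φ₀ - φ) x‖ ≤ ε / (C + 1)
    rw [integral_norm_eq_lintegral_enorm (hφ₀.1.sub hφi.1)]
    rw [eLpNorm_one_eq_lintegral_enorm] at hφ
    exact ENNReal.toReal_le_of_le_ofReal hδ.le hφ
  have hmem : MemLp (fun l : ℝ => ∫ x : ℝ, φ x * Complex.exp (Complex.I * l * x)) 2 μ :=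
    MemLp.of_bound (aux_cont φ hφi).aestronglyMeasurable _
      (Filter.Eventually.of_forall (aux_bound φ))
  refine ⟨hmem.toLp, ⟨φ, hφs, hφc, hmem.coeFn_toLp⟩, ?_⟩
  rw [dist_eq_norm]
  have hb : ∀ᵐ l ∂μ, ‖(f - hmem.toLp : Lp ℂ 2 μ) l‖ ≤ ε / (C + 1) := by
    filter_upwards [hfh, hmem.coeFn_toLp, Lp.coeFn_sub f hmem.toLp] with l h1 h2 h3
    rw [h3, Pi.sub_apply, h1, h2, ← hφh l,
      ← integral_sub (aux_integrable φ₀ hφ₀ l) (aux_integrable φ hφi l)]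
    simp_rw [← sub_mul]
    exact (aux_bound (fun x => φ₀ x - φ x) l).trans hL1
  have := Lp.norm_le_of_ae_bound hδ.le hb
  refine this.trans_lt ?_
  change C * (ε / (C + 1)) < ε
  rw [mul_div_assoc', div_lt_iff₀ (by positivity)]
  nlinarith
end

section
/- Let f be a tempered distribution on ℝ (a continuous linear functional on the Schwartz space) which is positive definite, i.e., for every Schwartz function φ : ℝ → ℂ, the value f(φ ⋆ φ♯) is a nonnegative real number, where (φ ⋆ ψ)(x) = ∫ℝ φ(y) ψ(x − y) dy is convolution and φ♯(x) = conj(φ(−x)). Then there exist a positive Borel measure μ on ℝ and M ∈ ℕ with ∫ℝ (1 + λ²)^{-M} dμ(λ) < ∞, such that f(φ) = ∫ℝ φ̂(λ) dμ(λ) for every Schwartz function φ. -/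
open MeasureTheory ComplexOrder

open SchwartzMap FourierTransform Convolution Filter Topology in
/-- positivity on squares after Fourier transform -/
lemma bs_sq (f : SchwartzMap ℝ ℂ →L[ℂ] ℂ)
    (hpd : ∀ φ ψ : SchwartzMap ℝ ℂ,
      (⇑ψ = fun x : ℝ => ∫ y : ℝ, φ y * (starRingEnd ℂ) (φ (-(x - y)))) → 0 ≤ f ψ)
    (h k : SchwartzMap ℝ ℂ) (hk : ∀ x, k x = h x * (starRingEnd ℂ) (h x)) :
    0 ≤ f (𝓕 k) := by
  apply hpd (𝓕 h)
  let hc : SchwartzMap ℝ ℂ := SchwartzMap.postcompCLM (𝕜 := ℝ) (Complex.conjCLE : ℂ →L[ℝ] ℂ) h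
  have hhc : ∀ x, hc x = (starRingEnd ℂ) (h x) := fun x => rfl
  have h1 : ∀ x, (starRingEnd ℂ) ((𝓕 h) (-x)) = (𝓕 hc) x := by
    intro x
    rw [SchwartzMap.fourier_coe, SchwartzMap.fourier_coe, Real.fourier_real_eq_integral_exp_smul,
      Real.fourier_real_eq_integral_exp_smul, ← integral_conj]
    congr 1
    ext v
    simp only [smul_eq_mul, map_mul, hhc]
    rw [← Complex.exp_conj]
    congr 2
    simp [Complex.conj_ofNat]
  have h2 : ∀ (g : SchwartzMap ℝ ℂ) x, (𝓕 (𝓕 g)) x = g (-x) := by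
    intro g x
    have : (𝓕⁻ (𝓕 g)) (-x) = (𝓕 (𝓕 g)) x := by
      rw [SchwartzMap.fourierInv_apply_eq]
      simp
    rw [← this]; simp
  ext x
  have h3 : SchwartzMap.convolution (ContinuousLinearMap.mul ℂ ℂ) (𝓕 h) (𝓕 hc) = 𝓕 k := by
    have : 𝓕⁻ (𝓕 (SchwartzMap.convolution (ContinuousLinearMap.mul ℂ ℂ) (𝓕 h) (𝓕 hc)))
        = 𝓕⁻ (𝓕 (𝓕 k)) := by
      congr 1
      rw [SchwartzMap.fourier_convolution]
      ext y
      rw [SchwartzMap.pairing_apply_apply, h2, h2, h2, hk, hhc]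
      rfl
    simpa using this
  rw [← h3, SchwartzMap.convolution_apply]
  simp only [convolution_def, ContinuousLinearMap.mul_apply']
  congr 1
  ext y
  rw [h1]

/-- smooth cutoff equal to one on a ball -/
lemma bs_bump (K : Set ℝ) (hK : IsCompact K) : ∃ χ : ℝ → ℝ, ContDiff ℝ (⊤ : ℕ∞) χ ∧
    HasCompactSupport χ ∧ (∀ x, 0 ≤ χ x) ∧ ∀ x ∈ K, χ x = 1 := by
  obtain ⟨R, hR⟩ := hK.isBounded.subset_closedBall 0
  let b : ContDiffBump (0 : ℝ) := ⟨|R| + 1, |R| + 2, by positivity, by linarith⟩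
  refine ⟨b, b.contDiff, b.hasCompactSupport, fun x => b.nonneg, fun x hx => ?_⟩
  apply b.one_of_mem_closedBall
  exact Metric.closedBall_subset_closedBall (by show R ≤ |R| + 1; linarith [le_abs_self R]) (hR hx)

/-- complex Schwartz function from a real smooth compactly supported function -/
noncomputable def bsS (χ : ℝ → ℝ) (h1 : ContDiff ℝ (⊤ : ℕ∞) χ) (h2 : HasCompactSupport χ) :
    SchwartzMap ℝ ℂ :=
  HasCompactSupport.toSchwartzMap (f := fun x => (χ x : ℂ))
    (h2.comp_left (g := fun t : ℝ => (t : ℂ)) (by simp)) (Complex.ofRealCLM.contDiff.comp h1)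

@[simp] lemma bsS_apply (χ : ℝ → ℝ) (h1 : ContDiff ℝ (⊤ : ℕ∞) χ) (h2 : HasCompactSupport χ) (x : ℝ) :
    bsS χ h1 h2 x = (χ x : ℂ) := rfl

open Filter Topology in
lemma bs_pos (T : SchwartzMap ℝ ℂ →L[ℂ] ℂ)
    (hT : ∀ h k : SchwartzMap ℝ ℂ, (∀ x, k x = h x * (starRingEnd ℂ) (h x)) → 0 ≤ T k)
    (g : ℝ → ℝ) (h1 : ContDiff ℝ (⊤ : ℕ∞) g) (h2 : HasCompactSupport g) (hg : ∀ x, 0 ≤ g x) :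
    0 ≤ T (bsS g h1 h2) := by
  obtain ⟨χ, c1, c2, c3, c4⟩ := bs_bump _ h2
  let X := bsS (fun x => χ x * χ x) (c1.mul c1) (c2.mul_left)
  have key : ∀ ε : ℝ, 0 < ε → 0 ≤ T (bsS g h1 h2) + ε * T X := by
    intro ε hε
    have s1 : ContDiff ℝ (⊤ : ℕ∞) (fun x => χ x * √(g x + ε)) := by
      apply c1.mul
      apply ContDiff.sqrt (h1.add contDiff_const)
      intro x
      have := hg x
      positivity
    have s2 : HasCompactSupport (fun x => χ x * √(g x + ε)) := c2.mul_right
    have := hT (bsS _ s1 s2) (bsS g h1 h2 + (ε : ℂ) • X) ?_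
    · simpa using this
    · intro x
      have e : g x * (χ x * χ x) = g x := by
        by_cases hx : x ∈ tsupport g
        · rw [c4 x hx]; ring
        · rw [image_eq_zero_of_notMem_tsupport hx]; ring
      have e2 := Real.mul_self_sqrt (add_nonneg (hg x) hε.le)
      simp only [add_apply, smul_apply, bsS_apply, X, Complex.conj_ofReal,
        smul_eq_mul]
      norm_cast
      calc g x + ε * (χ x * χ x) = (χ x * χ x) * (g x + ε) := by nlinarith
        _ = (χ x * χ x) * (√(g x + ε) * √(g x + ε)) := by rw [e2]
        _ = _ := by ring
  have lim : Tendsto (fun ε : ℝ => T (bsS g h1 h2) + ε * T X) (𝓝[>] 0) (𝓝 (T (bsS g h1 h2))) := by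
    have : Continuous (fun ε : ℝ => T (bsS g h1 h2) + ε * T X) := by fun_prop
    have := this.tendsto 0
    simp only [Complex.ofReal_zero, zero_mul, add_zero] at this
    exact this.mono_left nhdsWithin_le_nhds
  refine ge_of_tendsto lim ?_
  filter_upwards [self_mem_nhdsWithin] with ε hε using key ε hε

lemma bs_dom (g : ℝ → ℝ) (h1 : Continuous g) (h2 : HasCompactSupport g) :
    ∃ χ : ℝ → ℝ, ContDiff ℝ (⊤ : ℕ∞) χ ∧ HasCompactSupport χ ∧ (∀ x, 0 ≤ χ x) ∧ ∀ x, 0 ≤ χ x + g x := by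
  obtain ⟨χ, c1, c2, c3, c4⟩ := bs_bump _ h2
  obtain ⟨C, hC⟩ := h2.exists_bound_of_continuous h1
  refine ⟨fun x => |C| * χ x, contDiff_const.mul c1, c2.mul_left,
    fun x => mul_nonneg (abs_nonneg _) (c3 x), fun x => ?_⟩
  show 0 ≤ |C| * χ x + g x
  by_cases hx : x ∈ tsupport g
  · have := hC x
    rw [Real.norm_eq_abs] at this
    rw [c4 x hx]
    linarith [neg_abs_le (g x), le_abs_self C]
  · rw [image_eq_zero_of_notMem_tsupport hx]
    have := c3 x
    positivity

lemma bs_real (T : SchwartzMap ℝ ℂ →L[ℂ] ℂ)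
    (hT : ∀ h k : SchwartzMap ℝ ℂ, (∀ x, k x = h x * (starRingEnd ℂ) (h x)) → 0 ≤ T k)
    (g : ℝ → ℝ) (h1 : ContDiff ℝ (⊤ : ℕ∞) g) (h2 : HasCompactSupport g) :
    (T (bsS g h1 h2)).im = 0 := by
  obtain ⟨χ, c1, c2, c3, c4⟩ := bs_dom g h1.continuous h2
  have a := bs_pos T hT χ c1 c2 c3
  have b := bs_pos T hT (fun x => χ x + g x) (c1.add h1) (c2.add h2) c4
  have e : bsS (fun x => χ x + g x) (c1.add h1) (c2.add h2) = bsS χ c1 c2 + bsS g h1 h2 := by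
    ext x; simp
  rw [e, map_add] at b
  have a' := (Complex.le_def.1 a).2
  have b' := (Complex.le_def.1 b).2
  simp at a' b'
  rw [← a'] at b'
  simpa using b'.symm

open CompactlySupported in
lemma bs_measure (T : SchwartzMap ℝ ℂ →L[ℂ] ℂ)
    (hT : ∀ h k : SchwartzMap ℝ ℂ, (∀ x, k x = h x * (starRingEnd ℂ) (h x)) → 0 ≤ T k) :
    ∃ ν : Measure ℝ, IsFiniteMeasureOnCompacts ν ∧
      ∀ (g : ℝ → ℝ) (h1 : ContDiff ℝ (⊤ : ℕ∞) g) (h2 : HasCompactSupport g),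
      T (bsS g h1 h2) = ((∫ x, g x ∂ν : ℝ) : ℂ) := by
  let p : Submodule ℝ C_c(ℝ, ℝ) :=
    { carrier := {g | ContDiff ℝ (⊤ : ℕ∞) g}
      add_mem' := by
        intro a b ha hb
        rw [Set.mem_ofPred_eq] at *
        exact ha.add hb
      zero_mem' := by
        rw [Set.mem_ofPred_eq]
        exact contDiff_const (c := (0 : ℝ))
      smul_mem' := by
        intro c a ha
        rw [Set.mem_ofPred_eq] at *
        exact ha.const_smul c }
  have hp : ∀ g : C_c(ℝ, ℝ), g ∈ p ↔ ContDiff ℝ (⊤ : ℕ∞) g := fun g => Iff.rfl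
  let F : p →ₗ[ℝ] ℝ :=
    { toFun := fun g => (T (bsS g.1 ((hp _).1 g.2) g.1.hasCompactSupport)).re
      map_add' := by
        intro a b
        rw [← Complex.add_re, ← map_add]
        congr 2
        ext x
        simp
      map_smul' := by
        intro c a
        have : bsS (c • a).1 ((hp _).1 (c • a).2) (c • a).1.hasCompactSupport
          = (c : ℂ) • bsS a.1 ((hp _).1 a.2) a.1.hasCompactSupport := by
          ext x
          simp
        rw [this]
        simp }
  let s : PointedCone ℝ C_c(ℝ, ℝ) :=
    { carrier := {g | ∀ x, 0 ≤ g x}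
      add_mem' := by
        intro a b ha hb
        rw [Set.mem_ofPred_eq] at *
        exact fun x => add_nonneg (ha x) (hb x)
      zero_mem' := by
        rw [Set.mem_ofPred_eq]
        exact fun x => le_refl _
      smul_mem' := by
        intro c a ha
        rw [Set.mem_ofPred_eq] at *
        exact fun x => mul_nonneg c.2 (ha x) }
  have hs : ∀ g : C_c(ℝ, ℝ), g ∈ s ↔ ∀ x, 0 ≤ g x := fun g => Iff.rfl
  obtain ⟨L, hL1, hL2⟩ := riesz_extension s ⟨p, F⟩
    (by
      intro x hx
      exact (Complex.le_def.1 (bs_pos T hT x.1 ((hp _).1 x.2) x.1.hasCompactSupport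
        (fun y => (hs _).1 hx y))).1)
    (by
      intro y
      obtain ⟨χ, c1, c2, c3, c4⟩ := bs_dom y y.continuous y.hasCompactSupport
      exact ⟨⟨⟨⟨χ, c1.continuous⟩, c2⟩, (hp _).2 c1⟩, (hs _).2 c4⟩)
  let Λ : C_c(ℝ, ℝ) →ₚ[ℝ] ℝ := PositiveLinearMap.mk₀ L (fun x hx => hL2 x ((hs _).2 hx))
  refine ⟨RealRMK.rieszMeasure Λ, inferInstance, ?_⟩
  intro g h1 h2
  have e1 := RealRMK.integral_rieszMeasure Λ ⟨⟨g, h1.continuous⟩, h2⟩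
  have e2 := hL1 ⟨⟨⟨g, h1.continuous⟩, h2⟩, (hp _).2 h1⟩
  have e3 : (T (bsS g h1 h2)).re = ∫ x, g x ∂(RealRMK.rieszMeasure Λ) := e2.symm.trans e1.symm
  apply Complex.ext
  · simpa using e3
  · rw [bs_real T hT]; simp

/-- the basic bump function -/
noncomputable def bsb : ContDiffBump (0 : ℝ) := ⟨1, 2, one_pos, one_lt_two⟩

lemma bsb_one {y : ℝ} (hy : |y| ≤ 1) : bsb y = 1 :=
  bsb.one_of_mem_closedBall (by simpa [bsb] using hy)

/-- the scaled bump function -/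
noncomputable def bsc (n : ℕ) (x : ℝ) : ℝ := bsb (((n : ℝ) + 1)⁻¹ * x)

lemma bsc_contDiff (n : ℕ) : ContDiff ℝ (⊤ : ℕ∞) (bsc n) :=
  bsb.contDiff.comp (contDiff_const.mul contDiff_id)

lemma bsc_compact (n : ℕ) : HasCompactSupport (bsc n) := by
  have h : (((n : ℝ) + 1)⁻¹) ≠ 0 := by positivity
  exact bsb.hasCompactSupport.comp_homeomorph (Homeomorph.mulLeft₀ _ h)

lemma bsc_nonneg (n : ℕ) (x : ℝ) : 0 ≤ bsc n x := bsb.nonneg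

lemma bsc_one (n : ℕ) (x : ℝ) (hx : |x| ≤ n + 1) : bsc n x = 1 := by
  apply bsb_one
  have : (0 : ℝ) < n + 1 := by positivity
  rw [abs_mul, abs_of_pos (inv_pos.2 this), inv_mul_le_iff₀ this]
  simpa using hx

/-- scaled cutoffs as Schwartz functions -/
noncomputable def bsX (n : ℕ) : SchwartzMap ℝ ℂ := bsS (bsc n) (bsc_contDiff n) (bsc_compact n)

lemma bsX_eq (n : ℕ) (x : ℝ) : bsX n x = bsX 0 (((n : ℝ) + 1)⁻¹ * x) := by
  simp [bsX, bsc]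

lemma bsX_deriv (n m : ℕ) (x : ℝ) : iteratedDeriv m (bsX n) x
    = ((((n : ℝ) + 1)⁻¹) ^ m) • iteratedDeriv m (bsX 0) (((n : ℝ) + 1)⁻¹ * x) := by
  have : (bsX n : ℝ → ℂ) = fun x => bsX 0 (((n : ℝ) + 1)⁻¹ * x) := funext (bsX_eq n)
  rw [this, iteratedDeriv_comp_const_smul ((bsX 0).smooth m)]

lemma bsX_seminorm (n k m : ℕ) : SchwartzMap.seminorm ℂ k m (bsX n) ≤
    ((n : ℝ) + 1) ^ k * SchwartzMap.seminorm ℂ k m (bsX 0) := by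
  apply SchwartzMap.seminorm_le_bound'
  · positivity
  intro x
  rw [bsX_deriv, norm_smul]
  have h0 := SchwartzMap.le_seminorm' ℂ k m (bsX 0) (((n : ℝ) + 1)⁻¹ * x)
  have hn : (0 : ℝ) < n + 1 := by positivity
  set c := ((n : ℝ) + 1)⁻¹ with hc
  have hc1 : c ≤ 1 := inv_le_one_of_one_le₀ (by linarith [n.cast_nonneg (α := ℝ)])
  have hc0 : 0 < c := by positivity
  have e : |x| ^ k = ((n : ℝ) + 1) ^ k * |c * x| ^ k := by
    rw [← mul_pow, abs_mul, abs_of_pos hc0, hc, mul_inv_cancel_left₀ hn.ne']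
  have hcm : ‖c ^ m‖ ≤ 1 := by
    rw [norm_pow, Real.norm_of_nonneg hc0.le]; exact pow_le_one₀ hc0.le hc1
  calc |x| ^ k * (‖c ^ m‖ * ‖iteratedDeriv m (bsX 0) (c * x)‖)
      ≤ |x| ^ k * (1 * ‖iteratedDeriv m (bsX 0) (c * x)‖) := by gcongr
    _ = ((n : ℝ) + 1) ^ k * (|c * x| ^ k * ‖iteratedDeriv m (bsX 0) (c * x)‖) := by rw [e]; ring
    _ ≤ _ := by gcongr

lemma bs_growth (T : SchwartzMap ℝ ℂ →L[ℂ] ℂ) :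
    ∃ (C : ℝ) (K : ℕ), 0 ≤ C ∧ ∀ n : ℕ, ‖T (bsX n)‖ ≤ C * ((n : ℝ) + 1) ^ K := by
  obtain ⟨s, C, -, hC⟩ := Seminorm.bound_of_continuous (schwartz_withSeminorms ℂ ℝ ℂ)
    ((normSeminorm ℂ ℂ).comp T.toLinearMap) (by
      show Continuous (fun x => ‖T x‖)
      fun_prop)
  refine ⟨C * ∑ i ∈ s, SchwartzMap.seminorm ℂ i.1 i.2 (bsX 0), s.sup Prod.fst, by positivity, ?_⟩
  intro n
  have h1 : ‖T (bsX n)‖ ≤ C * (s.sup (schwartzSeminormFamily ℂ ℝ ℂ)) (bsX n) := hC (bsX n)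
  have h2 : (s.sup (schwartzSeminormFamily ℂ ℝ ℂ)) (bsX n) ≤
      (∑ i ∈ s, SchwartzMap.seminorm ℂ i.1 i.2 (bsX 0)) * ((n : ℝ) + 1) ^ (s.sup Prod.fst) := by
    apply Seminorm.finset_sup_apply_le (by positivity)
    intro i hi
    have h3 : SchwartzMap.seminorm ℂ i.1 i.2 (bsX 0) ≤
        ∑ i ∈ s, SchwartzMap.seminorm ℂ i.1 i.2 (bsX 0) :=
      Finset.single_le_sum (f := fun i : ℕ × ℕ => SchwartzMap.seminorm ℂ i.1 i.2 (bsX 0))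
        (fun j _ => by positivity) hi
    have h4 : i.1 ≤ s.sup Prod.fst := Finset.le_sup (f := Prod.fst) hi
    refine (bsX_seminorm n i.1 i.2).trans ?_
    rw [mul_comm]
    gcongr
    linarith [n.cast_nonneg (α := ℝ)]
  calc _ ≤ _ := h1
    _ ≤ C * ((∑ i ∈ s, SchwartzMap.seminorm ℂ i.1 i.2 (bsX 0)) *
      ((n : ℝ) + 1) ^ (s.sup Prod.fst)) := by gcongr
    _ = _ := by ring

/-- the complementary cutoff -/
noncomputable def bse (n : ℕ) (x : ℝ) : ℂ := 1 - bsX n x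

lemma bse_contDiff (n : ℕ) (m : ℕ∞) : ContDiff ℝ m (bse n) := contDiff_const.sub ((bsX n).smooth m)

lemma bse_bound (i : ℕ) : ∃ C : ℝ, 0 ≤ C ∧ ∀ y, ‖iteratedDeriv i (bse 0) y‖ ≤ C := by
  refine ⟨1 + SchwartzMap.seminorm ℂ 0 i (bsX 0), by positivity, fun y => ?_⟩
  have : iteratedDeriv i (bse 0) y
      = iteratedDeriv i (fun _ => (1 : ℂ)) y - iteratedDeriv i (bsX 0) y := by
    exact iteratedDeriv_sub contDiffAt_const ((bsX 0).smooth i).contDiffAt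
  rw [this]
  refine (norm_sub_le _ _).trans ?_
  gcongr
  · rw [iteratedDeriv_const]; split_ifs <;> simp
  · simpa using SchwartzMap.le_seminorm' ℂ 0 i (bsX 0) y

lemma bse_deriv (n m : ℕ) (x : ℝ) : iteratedDeriv m (bse n) x
    = ((((n : ℝ) + 1)⁻¹) ^ m) • iteratedDeriv m (bse 0) (((n : ℝ) + 1)⁻¹ * x) := by
  have : bse n = fun x => bse 0 (((n : ℝ) + 1)⁻¹ * x) := by
    ext x; rw [bse, bsX_eq]; rfl
  rw [this, iteratedDeriv_comp_const_smul (bse_contDiff 0 m)]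

lemma bse_zero (m : ℕ) (y : ℝ) (hy : |y| < 1) : iteratedDeriv m (bse 0) y = 0 := by
  have : bse 0 =ᶠ[nhds y] fun _ => (0 : ℂ) := by
    have : {z : ℝ | |z| < 1} ∈ nhds y := (isOpen_lt continuous_abs continuous_const).mem_nhds hy
    filter_upwards [this] with z hz
    have hz' : |z| < 1 := hz
    have := bsc_one 0 z (by simpa using hz'.le)
    simp [bse, bsX, this]
  rw [this.iteratedDeriv_eq, iteratedDeriv_const]
  simp

lemma bse_est (i : ℕ) : ∃ C : ℝ, 0 ≤ C ∧ ∀ (n : ℕ) x,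
    ‖iteratedDeriv i (bse n) x‖ ≤ C * (((n : ℝ) + 1)⁻¹ * |x|) := by
  obtain ⟨C, hC0, hC⟩ := bse_bound i
  refine ⟨C, hC0, fun n x => ?_⟩
  rw [bse_deriv, norm_smul]
  have hn : (0 : ℝ) < n + 1 := by positivity
  set c := ((n : ℝ) + 1)⁻¹ with hc
  have hc1 : c ≤ 1 := inv_le_one_of_one_le₀ (by linarith [n.cast_nonneg (α := ℝ)])
  have hc0 : 0 < c := by positivity
  have hcm : ‖c ^ i‖ ≤ 1 := by
    rw [norm_pow, Real.norm_of_nonneg hc0.le]; exact pow_le_one₀ hc0.le hc1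
  by_cases h : |c * x| < 1
  · rw [bse_zero i _ h]; simp; positivity
  · rw [abs_mul, abs_of_pos hc0] at h
    calc _ ≤ 1 * C := by gcongr; exact hC _
      _ = C * 1 := by ring
      _ ≤ _ := by gcongr; linarith

/-- truncation of a Schwartz function -/
noncomputable def bsu (g : SchwartzMap ℝ ℂ) (n : ℕ) : SchwartzMap ℝ ℂ :=
  SchwartzMap.pairing (ContinuousLinearMap.mul ℂ ℂ) (bsX n) g

lemma bsu_apply (g : SchwartzMap ℝ ℂ) (n : ℕ) (x : ℝ) : bsu g n x = bsX n x * g x := by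
  simp [bsu, SchwartzMap.pairing_apply_apply]

lemma bsu_est (g : SchwartzMap ℝ ℂ) (k m : ℕ) : ∃ C : ℝ, 0 ≤ C ∧ ∀ n : ℕ,
    SchwartzMap.seminorm ℂ k m (bsu g n - g) ≤ C * ((n : ℝ) + 1)⁻¹ := by
  choose C hC0 hC using bse_est
  refine ⟨∑ i ∈ Finset.range (m + 1), (m.choose i : ℝ) * C i *
    SchwartzMap.seminorm ℂ (k + 1) (m - i) g, ?_, fun n => ?_⟩
  · exact Finset.sum_nonneg fun i _ => mul_nonneg (mul_nonneg (by positivity) (hC0 i)) (by positivity)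
  have hS : 0 ≤ ∑ i ∈ Finset.range (m + 1), (m.choose i : ℝ) * C i *
    SchwartzMap.seminorm ℂ (k + 1) (m - i) g :=
     Finset.sum_nonneg fun i _ => mul_nonneg (mul_nonneg (by positivity) (hC0 i)) (by positivity)
  rw [map_sub_rev]
  apply SchwartzMap.seminorm_le_bound
  · positivity
  intro x
  have e : ((g - bsu g n : SchwartzMap ℝ ℂ) : ℝ → ℂ) = fun x => bse n x * g x := by
    ext x; simp [bsu_apply, bse]; ring
  rw [e]
  have h := norm_iteratedFDeriv_mul_le (𝕜 := ℝ) (bse_contDiff n m) (g.smooth m) x (le_refl _)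
  calc _ ≤ ‖x‖ ^ k * ∑ i ∈ Finset.range (m + 1),
        (m.choose i : ℝ) * ‖iteratedFDeriv ℝ i (bse n) x‖ * ‖iteratedFDeriv ℝ (m - i) g x‖ := by
        gcongr
    _ ≤ _ := by
      rw [Finset.mul_sum, Finset.sum_mul]
      apply Finset.sum_le_sum
      intro i _
      have a := hC i n x
      have b := SchwartzMap.le_seminorm ℂ (k + 1) (m - i) g x
      have := hC0 i
      rw [norm_iteratedFDeriv_eq_norm_iteratedDeriv (n := i)]
      calc _ ≤ ‖x‖ ^ k * ((m.choose i : ℝ) * (C i * (((n : ℝ) + 1)⁻¹ * |x|)) *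
            ‖iteratedFDeriv ℝ (m - i) g x‖) := by gcongr
        _ = (m.choose i : ℝ) * C i * ((n : ℝ) + 1)⁻¹ *
            (‖x‖ ^ (k + 1) * ‖iteratedFDeriv ℝ (m - i) g x‖) := by
            rw [Real.norm_eq_abs]; ring
        _ ≤ (m.choose i : ℝ) * C i * ((n : ℝ) + 1)⁻¹ *
            SchwartzMap.seminorm ℂ (k + 1) (m - i) g := by gcongr
        _ = _ := by ring

open Filter Topology in
lemma bsu_tendsto (g : SchwartzMap ℝ ℂ) : Tendsto (bsu g) atTop (𝓝 g) := by
  rw [(schwartz_withSeminorms ℂ ℝ ℂ).tendsto_nhds]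
  rintro ⟨k, m⟩ ε hε
  obtain ⟨C, hC0, hC⟩ := bsu_est g k m
  have : Tendsto (fun n : ℕ => C * ((n : ℝ) + 1)⁻¹) atTop (𝓝 (C * 0)) := by
    apply Tendsto.const_mul
    simpa using tendsto_one_div_add_atTop_nhds_zero_nat (𝕜 := ℝ)
  rw [mul_zero] at this
  filter_upwards [this.eventually_lt_const hε] with n hn
  exact (hC n).trans_lt hn

open Filter Topology in
lemma bs_dense (T S : SchwartzMap ℝ ℂ →L[ℂ] ℂ)
    (h : ∀ (g : ℝ → ℝ) (h1 : ContDiff ℝ (⊤ : ℕ∞) g) (h2 : HasCompactSupport g),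
      T (bsS g h1 h2) = S (bsS g h1 h2)) (g : SchwartzMap ℝ ℂ) : T g = S g := by
  have key : ∀ n, T (bsu g n) = S (bsu g n) := by
    intro n
    have r1 : ContDiff ℝ (⊤ : ℕ∞) (fun x => bsc n x * (g x).re) :=
      (bsc_contDiff n).mul (Complex.reCLM.contDiff.comp (g.smooth _))
    have i1 : ContDiff ℝ (⊤ : ℕ∞) (fun x => bsc n x * (g x).im) :=
      (bsc_contDiff n).mul (Complex.imCLM.contDiff.comp (g.smooth _))
    have r2 : HasCompactSupport (fun x => bsc n x * (g x).re) := (bsc_compact n).mul_right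
    have i2 : HasCompactSupport (fun x => bsc n x * (g x).im) := (bsc_compact n).mul_right
    have e : bsu g n = bsS _ r1 r2 + Complex.I • bsS _ i1 i2 := by
      ext x
      simp only [bsu_apply, bsX, add_apply, smul_apply, bsS_apply, smul_eq_mul]
      conv_lhs => rw [← Complex.re_add_im (g x)]
      push_cast
      ring
    rw [e, map_add, map_add, map_smul, map_smul, h, h]
  have a := (T.continuous.tendsto g).comp (bsu_tendsto g)
  have b := (S.continuous.tendsto g).comp (bsu_tendsto g)
  refine tendsto_nhds_unique a (b.congr fun n => (key n).symm)

lemma bs_temperate (T : SchwartzMap ℝ ℂ →L[ℂ] ℂ) (ν : Measure ℝ) [IsFiniteMeasureOnCompacts ν]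
    (h : ∀ (g : ℝ → ℝ) (h1 : ContDiff ℝ (⊤ : ℕ∞) g) (h2 : HasCompactSupport g),
      T (bsS g h1 h2) = ((∫ x, g x ∂ν : ℝ) : ℂ)) : ν.HasTemperateGrowth := by
  obtain ⟨C, K, hC0, hC⟩ := bs_growth T
  have hball : ∀ n : ℕ, ν (Metric.closedBall 0 ((n : ℝ) + 1))
      ≤ ENNReal.ofReal (C * ((n : ℝ) + 1) ^ K) := by
    intro n
    have e := hC n
    rw [bsX, h, Complex.norm_real] at e
    have hint : Integrable (bsc n) ν :=
      (bsc_contDiff n).continuous.integrable_of_hasCompactSupport (bsc_compact n)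
    calc ν (Metric.closedBall 0 ((n : ℝ) + 1))
        = ∫⁻ x in Metric.closedBall 0 ((n : ℝ) + 1), 1 ∂ν := by simp
      _ ≤ ∫⁻ x in Metric.closedBall 0 ((n : ℝ) + 1), ENNReal.ofReal (bsc n x) ∂ν := by
          apply setLIntegral_mono' Metric.isClosed_closedBall.measurableSet
          intro x hx
          rw [bsc_one n x (by simpa using hx)]; simp
      _ ≤ ∫⁻ x, ENNReal.ofReal (bsc n x) ∂ν := setLIntegral_le_lintegral _ _
      _ = ENNReal.ofReal (∫ x, bsc n x ∂ν) :=
          (ofReal_integral_eq_lintegral_ofReal hint (Filter.Eventually.of_forall (bsc_nonneg n))).symm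
      _ ≤ _ := ENNReal.ofReal_le_ofReal ((le_abs_self _).trans e)
  refine ⟨⟨K + 2, ?_⟩⟩
  have hcont : Continuous (fun x : ℝ => (1 + ‖x‖) ^ (-((K + 2 : ℕ) : ℝ))) := by
    apply Continuous.rpow_const (by fun_prop)
    intro x; left; positivity
  refine ⟨hcont.aestronglyMeasurable, ?_⟩
  rw [hasFiniteIntegral_iff_ofReal (Filter.Eventually.of_forall fun x => by positivity)]
  let A : ℕ → Set ℝ := fun n => {x | ⌊|x|⌋₊ = n}
  have hA : (⋃ n, A n) = Set.univ := by
    ext x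
    simp only [Set.mem_iUnion, Set.mem_univ, iff_true]
    exact ⟨⌊|x|⌋₊, rfl⟩
  have hAm : ∀ n, MeasurableSet (A n) := fun n =>
    (Nat.measurable_floor.comp measurable_norm) (measurableSet_singleton n)
  rw [← setLIntegral_univ, ← hA]
  refine (lintegral_iUnion_le _ _).trans_lt ?_
  have hb : ∀ n : ℕ, ∫⁻ x in A n, ENNReal.ofReal ((1 + ‖x‖) ^ (-((K + 2 : ℕ) : ℝ))) ∂ν ≤
      ENNReal.ofReal (C * (1 / ((n : ℝ) + 1) ^ 2)) := by
    intro n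
    have hn : (0 : ℝ) < n + 1 := by positivity
    calc _ ≤ ∫⁻ x in A n, ENNReal.ofReal ((((n : ℝ) + 1) ^ (K + 2))⁻¹) ∂ν := by
          apply setLIntegral_mono' (hAm n)
          intro x hx
          apply ENNReal.ofReal_le_ofReal
          rw [Real.rpow_neg (by positivity), Real.rpow_natCast]
          have hx' : ⌊|x|⌋₊ = n := hx
          have : (n : ℝ) ≤ |x| := by rw [← hx']; exact Nat.floor_le (abs_nonneg x)
          have : (n : ℝ) + 1 ≤ 1 + ‖x‖ := by rw [Real.norm_eq_abs]; linarith
          gcongr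
      _ = ENNReal.ofReal ((((n : ℝ) + 1) ^ (K + 2))⁻¹) * ν (A n) := by simp
      _ ≤ ENNReal.ofReal ((((n : ℝ) + 1) ^ (K + 2))⁻¹) *
            ENNReal.ofReal (C * ((n : ℝ) + 1) ^ K) := by
          gcongr
          refine (measure_mono ?_).trans (hball n)
          intro x hx
          have hx' : ⌊|x|⌋₊ = n := hx
          have := Nat.lt_floor_add_one |x|
          rw [hx'] at this
          simpa using this.le
      _ = _ := by
          rw [← ENNReal.ofReal_mul (by positivity)]
          congr 1
          field_simp
          ring
  refine (ENNReal.tsum_le_tsum hb).trans_lt ?_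
  have hs : Summable (fun n : ℕ => C * (1 / ((n : ℝ) + 1) ^ 2)) := by
    apply Summable.mul_left
    have := (summable_nat_add_iff 1).2 (Real.summable_one_div_nat_pow.2 (one_lt_two))
    simpa using this
  rw [← ENNReal.ofReal_tsum_of_nonneg (fun n => by positivity) hs]
  exact ENNReal.ofReal_lt_top

open FourierTransform in
/-- Bochner–Schwartz theorem: a positive definite tempered distribution `f` (meaning
`f(φ ⋆ φ♯) ≥ 0` for every Schwartz function `φ`, where `φ♯(x) = conj(φ(-x))`) is
represented by a tempered positive measure `μ`:
`f(φ) = ∫ φ̂(λ) dμ(λ)` with `∫ (1+λ²)^{-M} dμ(λ) < ∞` for some `M ∈ ℕ`. -/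
theorem stmt_6 (f : SchwartzMap ℝ ℂ →L[ℂ] ℂ)
    (hpd : ∀ φ ψ : SchwartzMap ℝ ℂ,
      (⇑ψ = fun x : ℝ => ∫ y : ℝ, φ y * (starRingEnd ℂ) (φ (-(x - y)))) → 0 ≤ f ψ) :
    ∃ (μ : Measure ℝ) (M : ℕ),
      (∫⁻ l : ℝ, ENNReal.ofReal (((1 + l ^ 2) ^ M)⁻¹) ∂μ < ⊤) ∧
      ∀ φ : SchwartzMap ℝ ℂ,
        Integrable (fun l : ℝ => ∫ x : ℝ, φ x * Complex.exp (Complex.I * l * x)) μ ∧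
        f φ = ∫ l : ℝ, (∫ x : ℝ, φ x * Complex.exp (Complex.I * l * x)) ∂μ := by
  let T : SchwartzMap ℝ ℂ →L[ℂ] ℂ := f ∘L (FourierTransform.fourierCLM ℂ (SchwartzMap ℝ ℂ))
  have hTdef : ∀ g, T g = f (𝓕 g) := fun g => rfl
  have hT : ∀ h k : SchwartzMap ℝ ℂ, (∀ x, k x = h x * (starRingEnd ℂ) (h x)) → 0 ≤ T k :=
    fun h k hk => bs_sq f hpd h k hk
  obtain ⟨ν, hν, hrep⟩ := bs_measure T hT
  have hν2 : ν.HasTemperateGrowth := bs_temperate T ν hrep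
  have hrep2 : ∀ g : SchwartzMap ℝ ℂ, T g = ∫ x, g x ∂ν := by
    intro g
    rw [← SchwartzMap.integralCLM_apply ℂ]
    apply bs_dense
    intro g h1 h2
    rw [hrep, SchwartzMap.integralCLM_apply, ← integral_complex_ofReal]
    rfl
  have hpi : (2 * Real.pi) ≠ 0 := by positivity
  let e : ℝ ≃ᵐ ℝ := (Homeomorph.mulLeft₀ (2 * Real.pi) hpi).toMeasurableEquiv
  have he : ∀ x, e x = 2 * Real.pi * x := fun x => rfl
  obtain ⟨N, hN⟩ := hν2.exists_integrable
  refine ⟨ν.map e, N, ?_, ?_⟩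
  · rw [lintegral_map_equiv]
    have hN' := hN.const_mul ((2 : ℝ) ^ N)
    refine lt_of_le_of_lt (lintegral_mono fun l => ?_) hN'.lintegral_lt_top
    apply ENNReal.ofReal_le_ofReal
    rw [Real.rpow_neg (by positivity), Real.rpow_natCast, he, ← inv_pow, ← inv_pow, ← mul_pow]
    apply pow_le_pow_left₀ (by positivity)
    rw [inv_le_iff_one_le_mul₀ (by positivity), mul_assoc, mul_comm, mul_assoc,
      le_inv_mul_iff₀ (by positivity), Real.norm_eq_abs]
    have h3 : l ^ 2 ≤ (2 * Real.pi * l) ^ 2 := by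
      have := Real.pi_gt_three
      rw [mul_pow]
      have h1 : (1 : ℝ) ≤ (2 * Real.pi) ^ 2 := by nlinarith
      nlinarith [sq_nonneg l]
    have h4 := sq_abs l
    nlinarith [sq_nonneg (|l| - 1)]
  · intro φ
    have h5 : ∀ l : ℝ, (∫ x : ℝ, φ x * Complex.exp (Complex.I * (e l : ℝ) * x)) = (𝓕⁻ φ) l := by
      intro l
      rw [SchwartzMap.fourierInv_coe, Real.fourierInv_eq']
      congr 1
      ext x
      rw [smul_eq_mul, mul_comm, he]
      congr 2
      simp
      ring
    constructor
    · rw [integrable_map_equiv]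
      refine ((𝓕⁻ φ).integrable (μ := ν)).congr (Filter.Eventually.of_forall fun l => ?_)
      exact (h5 l).symm
    · rw [integral_map_equiv]
      simp_rw [h5]
      rw [← hrep2, hTdef]
      simp
end

section
/- Let a > 0 and let f : (−a, a) → ℂ be a continuous function that is positive definite on the interval, i.e., for every n ∈ ℕ, all points x₁,…,xₙ ∈ (0, a) and all scalars c₁,…,cₙ ∈ ℂ, the sum ∑ᵢ∑ⱼ cᵢ·conj(cⱼ)·f(xᵢ − xⱼ) is a nonnegative real number. Then there exists a continuous positive definite function F : ℝ → ℂ such that F(x) = f(x) for all x ∈ (−a, a). -/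
open MeasureTheory ComplexOrder

open scoped MatrixOrder in
/-- Toeplitz extension: a finite family of vectors with Toeplitz Gram matrix is an orbit
of a unitary operator. -/
lemma toeplitz_ext (N : ℕ) (g : ℤ → ℂ)
    (hpd : ∀ c : Fin (N+1) → ℂ,
      0 ≤ ∑ i, ∑ j, c i * (starRingEnd ℂ) (c j) * g ((i : ℤ) - (j : ℤ)))
    (hherm : ∀ m : ℤ, |m| < N + 1 → g (-m) = (starRingEnd ℂ) (g m)) :
    ∃ s : ℤ → ℂ, (∀ (n : ℕ) (x : Fin n → ℤ) (c : Fin n → ℂ),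
        0 ≤ ∑ i, ∑ j, c i * (starRingEnd ℂ) (c j) * s (x i - x j)) ∧
      (∀ m : ℤ, |m| < N + 1 → s m = g m) ∧
      (∀ m, ‖s m‖ ≤ (g 0).re) ∧
      (∀ m m', ‖s m - s m'‖ ^ 2 ≤ 2 * (g 0).re * ((g 0).re - (s (m - m')).re)) := by
  classical
  let A : Matrix (Fin (N+1)) (Fin (N+1)) ℂ := Matrix.of fun j i => g ((i : ℤ) - (j : ℤ))
  have hA : A.PosSemidef := by
    refine Matrix.PosSemidef.of_dotProduct_mulVec_nonneg ?_ ?_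
    · ext j i
      simp only [Matrix.conjTranspose_apply, A, Matrix.of_apply]
      rw [← neg_sub, hherm, RCLike.star_def, Complex.conj_conj]
      rw [abs_lt]; constructor <;> omega
    · intro c
      convert hpd c using 1
      simp only [dotProduct, Matrix.mulVec, A, Matrix.of_apply, Finset.mul_sum, Pi.star_apply, RCLike.star_def]
      rw [Finset.sum_comm]
      refine Finset.sum_congr rfl fun i _ => Finset.sum_congr rfl fun j _ => ?_
      ring
  obtain ⟨B, hB⟩ : ∃ B : Matrix (Fin (N+1)) (Fin (N+1)) ℂ, A = B.conjTranspose * B :=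
    CStarAlgebra.nonneg_iff_eq_star_mul_self.1 hA.nonneg
  let v : Fin (N+1) → EuclideanSpace ℂ (Fin (N+1)) := fun i => WithLp.toLp 2 (fun k => B k i)
  have hv : ∀ i j, inner ℂ (v j) (v i) = g ((i : ℤ) - (j : ℤ)) := by
    intro i j
    have : A j i = g ((i : ℤ) - (j : ℤ)) := rfl
    rw [← this, hB, PiLp.inner_apply, Matrix.mul_apply]
    refine Finset.sum_congr rfl fun k _ => ?_
    simp [v, Matrix.conjTranspose_apply, mul_comm]
  let T : (Fin N → ℂ) →ₗ[ℂ] EuclideanSpace ℂ (Fin (N+1)) := Fintype.linearCombination ℂ (fun i : Fin N => v i.castSucc)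
  let T' : (Fin N → ℂ) →ₗ[ℂ] EuclideanSpace ℂ (Fin (N+1)) := Fintype.linearCombination ℂ (fun i : Fin N => v i.succ)
  have hTT : ∀ c, ‖T' c‖ = ‖T c‖ := by
    intro c
    have : inner ℂ (T' c) (T' c) = inner ℂ (T c) (T c) := by
      simp only [T, T', Fintype.linearCombination_apply, sum_inner, inner_sum, inner_smul_left,
        inner_smul_right, hv]
      simp
    rw [inner_self_eq_norm_sq_to_K, inner_self_eq_norm_sq_to_K] at this
    have h2 : ‖T' c‖ ^ 2 = ‖T c‖ ^ 2 := by exact_mod_cast this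
    exact (pow_left_inj₀ (norm_nonneg _) (norm_nonneg _) two_ne_zero).1 h2
  obtain ⟨r, hr⟩ := T.rangeRestrict.exists_rightInverse_of_surjective T.range_rangeRestrict
  have hr' : ∀ x, T (r x) = x := fun x => by
    have := congrArg Subtype.val (LinearMap.congr_fun hr x)
    simpa using this
  let L : LinearMap.range T →ₗᵢ[ℂ] EuclideanSpace ℂ (Fin (N+1)) := ⟨T' ∘ₗ r, fun x => by
    rw [LinearMap.comp_apply, hTT, hr']; rfl⟩
  have hL : ∀ c, L ⟨T c, c, rfl⟩ = T' c := by
    intro c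
    change T' (r _) = T' c
    rw [← sub_eq_zero, ← map_sub, ← norm_eq_zero, hTT, map_sub, hr']
    simp
  let W : EuclideanSpace ℂ (Fin (N+1)) →ₗᵢ[ℂ] EuclideanSpace ℂ (Fin (N+1)) := L.extend
  let U : EuclideanSpace ℂ (Fin (N+1)) ≃ₗᵢ[ℂ] EuclideanSpace ℂ (Fin (N+1)) := W.toLinearIsometryEquiv rfl
  have hU : ∀ i : Fin N, U (v i.castSucc) = v i.succ := by
    intro i
    have h1 : T (Pi.single i 1) = v i.castSucc := by simp [T]
    have h2 : T' (Pi.single i 1) = v i.succ := by simp [T']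
    have h3 := L.extend_apply ⟨T (Pi.single i 1), _, rfl⟩
    rw [hL, h2] at h3
    simp only [h1] at h3
    exact h3
  have hUp : ∀ n : ℕ, ∀ hn : n < N + 1, (U ^ n) (v 0) = v ⟨n, hn⟩ := by
    intro n
    induction n with
    | zero => intro hn; simp
    | succ n ih =>
      intro hn
      rw [pow_succ', LinearIsometryEquiv.coe_mul, Function.comp_apply, ih (by omega)]
      exact hU ⟨n, by omega⟩
  have hin : ∀ m m' : ℤ, inner ℂ (v 0) ((U ^ (m - m')) (v 0)) =
      inner ℂ ((U ^ m') (v 0)) ((U ^ m) (v 0)) := by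
    intro m m'
    have e : (U ^ m') ((U ^ (m - m')) (v 0)) = (U ^ m) (v 0) := by
      have : U ^ m = U ^ m' * U ^ (m - m') := by rw [← zpow_add]; congr 1; ring
      rw [this]; rfl
    rw [← LinearIsometryEquiv.inner_map_map (U ^ m'), e]
  have hn0 : ∀ m : ℤ, ‖(U ^ m) (v 0)‖ ^ 2 = (g 0).re := by
    intro m
    rw [LinearIsometryEquiv.norm_map, ← inner_self_eq_norm_sq (𝕜 := ℂ), hv]
    simp
  have hn0' : ‖v 0‖ ^ 2 = (g 0).re := by simpa using hn0 0
  have hnn : ∀ m : ℤ, ‖(U ^ m) (v 0)‖ = ‖v 0‖ := fun m => LinearIsometryEquiv.norm_map _ _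
  have hpos : ∀ n : ℕ, n < N + 1 → inner ℂ (v 0) ((U ^ (n : ℤ)) (v 0)) = g n := by
    intro n hn
    rw [zpow_natCast, hUp n hn, hv]
    simp
  refine ⟨fun m => inner ℂ (v 0) ((U ^ m) (v 0)), ?_, ?_, ?_, ?_⟩
  · intro n x c
    have : ∑ i, ∑ j, c i * (starRingEnd ℂ) (c j) * inner ℂ (v 0) ((U ^ (x i - x j)) (v 0)) =
        inner ℂ (∑ i, c i • (U ^ x i) (v 0)) (∑ i, c i • (U ^ x i) (v 0)) := by
      simp only [sum_inner, inner_sum, inner_smul_left, inner_smul_right, hin, Finset.mul_sum]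
      refine Finset.sum_congr rfl fun i _ => Finset.sum_congr rfl fun j _ => ?_
      ring
    rw [this, inner_self_eq_norm_sq_to_K]
    norm_cast
    positivity
  · intro m hm
    rw [abs_lt] at hm
    obtain ⟨n, rfl | rfl⟩ := m.eq_nat_or_neg
    · exact hpos n (by omega)
    · have := hin 0 n
      rw [zero_sub] at this
      change inner ℂ (v 0) _ = _
      rw [this, hherm _ (by rw [abs_lt]; omega), ← hpos n (by omega), inner_conj_symm]
      simp
  · intro m
    refine (norm_inner_le_norm _ _).trans ?_
    rw [hnn, ← hn0', sq]
  · intro m m'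
    have h1 : ‖inner ℂ (v 0) ((U ^ m) (v 0)) - inner ℂ (v 0) ((U ^ m') (v 0))‖
        ≤ ‖v 0‖ * ‖(U ^ m) (v 0) - (U ^ m') (v 0)‖ := by
      rw [← inner_sub_right]; exact norm_inner_le_norm _ _
    have h2 := norm_sub_sq (𝕜 := ℂ) ((U ^ m) (v 0)) ((U ^ m') (v 0))
    rw [hn0, hn0] at h2
    have h3 : RCLike.re (inner ℂ ((U ^ m) (v 0)) ((U ^ m') (v 0))) =
        (inner ℂ (v 0) ((U ^ (m - m')) (v 0))).re := by
      rw [hin, inner_re_symm]; rfl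
    calc _ ≤ (‖v 0‖ * ‖(U ^ m) (v 0) - (U ^ m') (v 0)‖) ^ 2 := by gcongr
      _ = _ := by rw [mul_pow, hn0', h2, h3]; ring

open Filter Topology in
/-- A continuous function `f` on `(-a, a)` that is positive definite there (quadratic
sums over points of `(0, a)` are nonnegative) extends to a continuous positive definite
function `F` on all of `ℝ`. -/
theorem stmt_7 (a : ℝ) (ha : 0 < a) (f : ℝ → ℂ)
    (hf : ContinuousOn f (Set.Ioo (-a) a))
    (hpd : ∀ (n : ℕ) (x : Fin n → ℝ), (∀ i, x i ∈ Set.Ioo 0 a) → ∀ c : Fin n → ℂ,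
      0 ≤ ∑ i, ∑ j, c i * (starRingEnd ℂ) (c j) * f (x i - x j)) :
    ∃ F : ℝ → ℂ, Continuous F ∧
      (∀ (n : ℕ) (x : Fin n → ℝ) (c : Fin n → ℂ),
        0 ≤ ∑ i, ∑ j, c i * (starRingEnd ℂ) (c j) * F (x i - x j)) ∧
      ∀ x ∈ Set.Ioo (-a) a, F x = f x := by
  -- hermitian symmetry
  have hherm : ∀ x ∈ Set.Ioo (-a) a, f (-x) = (starRingEnd ℂ) (f x) := by
    intro x hx
    have hp : ∀ i, (![(a + x) / 2, (a - x) / 2] : Fin 2 → ℝ) i ∈ Set.Ioo 0 a := by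
      intro i
      obtain ⟨h1, h2⟩ := hx
      fin_cases i <;> constructor <;> simp <;> linarith
    have e1 : (a + x) / 2 - (a - x) / 2 = x := by ring
    have e2 : (a - x) / 2 - (a + x) / 2 = -x := by ring
    have h1 := hpd 2 _ hp ![1, 1]
    have h2 := hpd 2 _ hp ![1, Complex.I]
    have h0 := hpd 1 ![a / 2] (by intro i; fin_cases i; constructor <;> simp <;> linarith) ![1]
    simp [Fin.sum_univ_two, e1, e2, Complex.le_def] at h0 h1 h2
    apply Complex.ext
    · simp; linarith [h2.2, h0.2]
    · simp; linarith [h1.2, h0.2]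
  let h : ℕ → ℝ := fun k => a / ((k : ℝ) + 1)
  have hh : ∀ k, 0 < h k := fun k => by positivity
  have hmem : ∀ (k : ℕ) (m : ℤ), |m| < k + 1 ↔ (m : ℝ) * h k ∈ Set.Ioo (-a) a := by
    intro k m
    have hk : (0 : ℝ) < k + 1 := by positivity
    have e : (m : ℝ) * h k = a * (m / ((k : ℝ) + 1)) := by simp only [h]; ring
    rw [e, Set.mem_Ioo, ← abs_lt, abs_mul, abs_of_pos ha, mul_lt_iff_lt_one_right ha, abs_div,
      abs_of_pos hk, div_lt_one hk]
    exact_mod_cast Iff.rfl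
  have key := fun k : ℕ => toeplitz_ext k (fun m => f (m * h k)) (by
    intro c
    have := hpd (k + 1) (fun i => ((i : ℝ) + 1 / 2) * h k) (by
      intro i
      have hi : ((i : ℕ) : ℝ) + 1 ≤ (k : ℝ) + 1 := by exact_mod_cast i.2
      constructor
      · have := hh k; positivity
      · calc ((i : ℝ) + 1 / 2) * h k < ((k : ℝ) + 1) * h k := by
              exact mul_lt_mul_of_pos_right (by linarith) (hh k)
          _ = a := by simp only [h]; field_simp) c
    convert this using 6
    push_cast
    ring) (by
    intro m hm
    have := hherm _ ((hmem k m).1 hm)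
    simpa using this)
  choose s spd sf sb sd using key
  simp only [Int.cast_zero, zero_mul] at sb sd
  let u : Ultrafilter ℕ := hyperfilter ℕ
  have hu : (u : Filter ℕ) ≤ atTop := by
    rw [← Nat.cofinite_eq_atTop]; exact hyperfilter_le_cofinite
  have hh0 : Tendsto h u (𝓝 0) := by
    have : Tendsto h atTop (𝓝 0) := by
      have := (tendsto_one_div_add_atTop_nhds_zero_nat (𝕜 := ℝ)).const_mul a
      simpa [h, div_eq_mul_inv] using this
    exact this.mono_left hu
  have hlim : ∀ x : ℝ, ∃ z, Tendsto (fun k => s k ⌊x / h k⌋) u (𝓝 z) := by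
    intro x
    obtain ⟨z, -, hz⟩ := (isCompact_closedBall (0 : ℂ) (f 0).re).ultrafilter_le_nhds
      (u.map fun k => s k ⌊x / h k⌋) (by
        rw [le_principal_iff]
        have : ∀ k, s k ⌊x / h k⌋ ∈ Metric.closedBall (0 : ℂ) (f 0).re := fun k => by
          simpa using sb k _
        exact Ultrafilter.mem_map.2 (Filter.univ_mem' this))
    exact ⟨z, hz⟩
  choose F hF using hlim
  have hfl : ∀ x : ℝ, Tendsto (fun k => (⌊x / h k⌋ : ℝ) * h k) u (𝓝 x) := by
    intro x
    have h1 : Tendsto (fun k => x - h k) u (𝓝 x) := by simpa using hh0.const_sub x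
    refine tendsto_of_tendsto_of_tendsto_of_le_of_le h1 tendsto_const_nhds (fun k => ?_) fun k => ?_
    · have := Int.lt_floor_add_one (x / h k)
      rw [div_lt_iff₀ (hh k)] at this
      simp only; linarith
    · exact (le_div_iff₀ (hh k)).1 (Int.floor_le (x / h k))
  have hconv : ∀ t ∈ Set.Ioo (-a) a, ∀ p : ℕ → ℤ, Tendsto (fun k => (p k : ℝ) * h k) u (𝓝 t) →
      Tendsto (fun k => s k (p k)) u (𝓝 (f t)) := by
    intro t ht p hp
    have hc : ContinuousAt f t := hf.continuousAt (isOpen_Ioo.mem_nhds ht)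
    refine (hc.tendsto.comp hp).congr' ?_
    filter_upwards [hp (isOpen_Ioo.mem_nhds ht)] with k hk
    exact (sf k _ ((hmem k _).2 hk)).symm
  have h0 : (0 : ℝ) ∈ Set.Ioo (-a) a := ⟨by linarith, ha⟩
  have hsub : ∀ x y : ℝ, Tendsto (fun k => s k (⌊x / h k⌋ - ⌊y / h k⌋)) u (𝓝 (F (x - y))) := by
    intro x y
    have hd : Tendsto (fun k => s k (⌊x / h k⌋ - ⌊y / h k⌋ - ⌊(x - y) / h k⌋)) u (𝓝 (f 0)) := by
      apply hconv 0 h0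
      have := ((hfl x).sub (hfl y)).sub (hfl (x - y))
      rw [sub_self] at this
      refine this.congr fun k => ?_
      push_cast; ring
    have hsq : Tendsto (fun k => ‖s k (⌊x / h k⌋ - ⌊y / h k⌋) - s k ⌊(x - y) / h k⌋‖ ^ 2) u
        (𝓝 0) := by
      refine squeeze_zero (fun k => by positivity) (fun k => sd k _ _) ?_
      have := (((Complex.continuous_re.tendsto _).comp hd).const_sub (f 0).re).const_mul
        (2 * (f 0).re)
      simpa using this
    have hz : Tendsto (fun k => s k (⌊x / h k⌋ - ⌊y / h k⌋) - s k ⌊(x - y) / h k⌋) u (𝓝 0) := by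
      rw [tendsto_zero_iff_norm_tendsto_zero]
      have := hsq.sqrt
      simpa using this
    simpa using hz.add (hF (x - y))
  have hFf : ∀ x ∈ Set.Ioo (-a) a, F x = f x := fun x hx =>
    tendsto_nhds_unique (hF x) (hconv x hx _ (hfl x))
  refine ⟨F, ?_, ?_, hFf⟩
  · rw [continuous_iff_continuousAt]
    intro x
    have hb : ∀ y, y - x ∈ Set.Ioo (-a) a →
        ‖F y - F x‖ ^ 2 ≤ 2 * (f 0).re * ((f 0).re - (f (y - x)).re) := by
      intro y hy
      have h1 := (((hF y).sub (hF x)).norm).pow 2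
      have h2 := hsub y x
      rw [hFf _ hy] at h2
      have h3 := (((Complex.continuous_re.tendsto _).comp h2).const_sub (f 0).re).const_mul
        (2 * (f 0).re)
      exact le_of_tendsto_of_tendsto' h1 h3 fun k => sd k _ _
    have hyx : Tendsto (fun y => y - x) (𝓝 x) (𝓝 0) := by
      have : Continuous fun y : ℝ => y - x := by fun_prop
      simpa using this.tendsto x
    have hc : ContinuousAt f 0 := hf.continuousAt (isOpen_Ioo.mem_nhds h0)
    have hsq : Tendsto (fun y => ‖F y - F x‖ ^ 2) (𝓝 x) (𝓝 0) := by
      have := (((Complex.continuous_re.tendsto _).comp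
        (hc.tendsto.comp hyx)).const_sub (f 0).re).const_mul (2 * (f 0).re)
      rw [sub_self, mul_zero] at this
      refine squeeze_zero' (Eventually.of_forall fun k => by positivity) ?_ this
      filter_upwards [hyx (isOpen_Ioo.mem_nhds h0)] with y hy using hb y hy
    rw [ContinuousAt, tendsto_iff_norm_sub_tendsto_zero]
    have := hsq.sqrt
    simpa using this
  · intro n x c
    have : Tendsto (fun k => ∑ i, ∑ j, c i * (starRingEnd ℂ) (c j) *
        s k (⌊x i / h k⌋ - ⌊x j / h k⌋)) u
        (𝓝 (∑ i, ∑ j, c i * (starRingEnd ℂ) (c j) * F (x i - x j))) :=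
      tendsto_finsetSum _ fun i _ => tendsto_finsetSum _ fun j _ => (hsub _ _).const_mul _
    exact ge_of_tendsto' this fun k => spd k n (fun i => ⌊x i / h k⌋) c
end
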